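/- arXiv:math/0502166 — 3 statements merged into one kernel-verified Lean document; each statement's English description precedes it below -/
import Mathlib

section
/- Let G be a countable abelian group, Φ : ℤ[G] → ℂ a ring homomorphism, and regard ℂ as a ℤ[G]-module via Φ. Let M be a finitely generated ℤ[G]-module admitting a finite generating set containing an element a whose annihilator Ann_{ℤ[G]}(a) is contained in ker Φ. Then there exists a nonzero ℤ[G]-module homomorphism θ : M → ℂ. -/
noncomputable section

open TensorProduct in
theorem aux_hom {R : Type} [CommRing R] (Φ : R →+* ℂ)
    {M : Type} [AddCommGroup M] [Module R M] [Module.Finite R M]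
    (a : M) (hann : Ideal.torsionOf R M a ≤ RingHom.ker Φ) :
    ∃ θ : M →+ ℂ, θ ≠ 0 ∧ ∀ (f : R) (m : M), θ (f • m) = Φ f * θ m := by
  have hp : (RingHom.ker Φ).IsPrime := RingHom.ker_isPrime Φ
  have hs : (⟨RingHom.ker Φ, hp⟩ : PrimeSpectrum R) ∈ Module.support R M := by
    rw [Module.mem_support_iff']
    refine ⟨a, fun r hr h => hr (hann ?_)⟩
    rw [Ideal.mem_torsionOf_iff]
    exact h
  rw [Module.mem_support_iff_nontrivial_residueField_tensorProduct] at hs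
  change Nontrivial (TensorProduct R (RingHom.ker Φ).ResidueField M) at hs
  obtain ⟨x, hx⟩ := exists_ne (0 : TensorProduct R (RingHom.ker Φ).ResidueField M)
  obtain ⟨g, hg⟩ : ∃ g : Module.Dual (RingHom.ker Φ).ResidueField _, g x ≠ 0 := by
    by_contra! h
    exact hx ((Module.forall_dual_apply_eq_zero_iff (RingHom.ker Φ).ResidueField x).1 h)
  let j : (RingHom.ker Φ).ResidueField →+* ℂ :=
    Ideal.ResidueField.lift (RingHom.ker Φ) Φ le_rfl
      (fun r hr => IsUnit.mk0 _ (fun h => hr h))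
  have hj : ∀ r, j (algebraMap R _ r) = Φ r := fun r =>
    Ideal.ResidueField.lift_algebraMap _ _ _ _ r
  refine ⟨AddMonoidHom.mk' (fun m => j (g (1 ⊗ₜ[R] m))) ?_, ?_, ?_⟩
  · intro m n
    rw [TensorProduct.tmul_add, map_add, map_add]
  · intro h0
    apply hg
    have h1 : ∀ m, g (1 ⊗ₜ[R] m) = 0 := fun m =>
      j.injective (by rw [map_zero]; exact DFunLike.congr_fun h0 m)
    clear hg hx
    induction x with
    | zero => simp
    | tmul c m =>
      have : c ⊗ₜ[R] m = c • ((1 : (RingHom.ker Φ).ResidueField) ⊗ₜ[R] m) := by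
        rw [TensorProduct.smul_tmul', smul_eq_mul, mul_one]
      rw [this, map_smul, h1, smul_zero]
    | add x y hx hy => rw [map_add, hx, hy, add_zero]
  · intro f m
    change j (g (1 ⊗ₜ[R] (f • m))) = Φ f * j (g (1 ⊗ₜ[R] m))
    have : (1 : (RingHom.ker Φ).ResidueField) ⊗ₜ[R] (f • m) =
        (algebraMap R (RingHom.ker Φ).ResidueField f) • (1 ⊗ₜ[R] m) := by
      rw [algebraMap_smul, TensorProduct.tmul_smul]
    rw [this, map_smul, smul_eq_mul, map_mul, hj]

/-- if `G` is a countable abelian group, `Φ : ℤ[G] → ℂ` a ring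
homomorphism (making `ℂ` a `ℤ[G]`-module via `f • z = Φ(f)·z`), and `M` a finitely
generated `ℤ[G]`-module with a finite generating set containing an element `a` whose
annihilator is contained in `ker Φ`, then there is a nonzero `ℤ[G]`-module
homomorphism `θ : M → ℂ`, i.e. a nonzero additive map with `θ(f • m) = Φ(f)·θ(m)`. -/
theorem exists_nonzero_module_hom_to_C
    {G : Type} [CommGroup G] [Countable G]
    (Φ : MonoidAlgebra ℤ G →+* ℂ)
    {M : Type} [AddCommGroup M] [Module (MonoidAlgebra ℤ G) M]
    (a : M)
    (hgen : ∃ s : Finset M, a ∈ s ∧ Submodule.span (MonoidAlgebra ℤ G) (s : Set M) = ⊤)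
    (hann : Ideal.torsionOf (MonoidAlgebra ℤ G) M a ≤ RingHom.ker Φ) :
    ∃ θ : M →+ ℂ, θ ≠ 0 ∧
      ∀ (f : MonoidAlgebra ℤ G) (m : M), θ (f • m) = Φ f * θ m := by
  obtain ⟨s, -, hs⟩ := hgen
  have : Module.Finite (MonoidAlgebra ℤ G) M := ⟨⟨s, hs⟩⟩
  exact aux_hom Φ a hann
end
end

section
/- In the quotient ring M = R∞/(e(1) − 2), the ideal 𝔟 generated by the images of the elements e(n) + e(n+1) for even integers n ≥ 2 is a proper ideal of M which is not finitely generated as an R∞-module (equivalently, not finitely generated as a ℤ[Λ]-module, the R∞-module structure on M being induced by the quotient map R∞ → M). -/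
noncomputable section
set_option synthInstance.maxHeartbeats 1000000

/-- `Λ = ⊕_ℕ ℤ`, the group of eventually zero sequences of integers. -/
abbrev Lam : Type := ℕ →₀ ℤ

/-- `R∞ = ℤ[Λ]`, the integral group ring of `Λ`. -/
abbrev Rinf : Type := AddMonoidAlgebra ℤ Lam

/-- The `n`-th unit vector of `Λ`. -/
def e (n : ℕ) : Lam := Finsupp.single n 1

/-- The quotient ring `M = R∞/(e(1) - 2)`. -/
abbrev Mring : Type := Rinf ⧸ Ideal.span {(AddMonoidAlgebra.single (e 1) 1 - 2 : Rinf)}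

/-- The ideal `𝔟 ⊆ M` generated by the images of `e(n) + e(n+1)` for even `n ≥ 2`. -/
def bIdeal : Ideal Mring :=
  Ideal.span {y : Mring | ∃ n : ℕ, 2 ≤ n ∧ Even n ∧
    y = Ideal.Quotient.mk _ ((AddMonoidAlgebra.single (e n) 1 + AddMonoidAlgebra.single (e (n + 1)) 1 : Rinf))}

/-- The group homomorphism `Λ → ℚˣ` sending `e n` to `u n`. -/
def lamHom (u : ℕ → ℚˣ) : Lam →+ Additive ℚˣ :=
  Finsupp.liftAddHom (fun n => zmultiplesHom (Additive ℚˣ) (Additive.ofMul (u n)))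

/-- The induced ring homomorphism on the group ring. -/
def rHom (u : ℕ → ℚˣ) : Rinf →+* ℚ :=
  (AddMonoidAlgebra.lift ℤ ℚ Lam
    ((Units.coeHom ℚ).comp (AddMonoidHom.toMultiplicativeLeft (lamHom u)))).toRingHom

lemma rHom_single (u : ℕ → ℚˣ) (n : ℕ) :
    rHom u (AddMonoidAlgebra.single (e n) 1) = (u n : ℚ) := by
  simp [rHom, lamHom, e]

/-- The induced ring homomorphism on `M`. -/
def mHom (u : ℕ → ℚˣ) (hu : (u 1 : ℚ) = 2) : Mring →+* ℚ :=
  Ideal.Quotient.lift _ (rHom u) (by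
    intro a ha
    have : Ideal.span {(AddMonoidAlgebra.single (e 1) 1 - 2 : Rinf)} ≤ RingHom.ker (rHom u) := by
      rw [Ideal.span_le, Set.singleton_subset_iff, SetLike.mem_coe, RingHom.mem_ker, map_sub,
        rHom_single, hu, map_ofNat, sub_self]
    exact RingHom.mem_ker.mp (this ha))

lemma mHom_gen (u : ℕ → ℚˣ) (hu : (u 1 : ℚ) = 2) (n : ℕ) :
    mHom u hu (Ideal.Quotient.mk _
      ((AddMonoidAlgebra.single (e n) 1 + AddMonoidAlgebra.single (e (n + 1)) 1 : Rinf)))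
      = (u n : ℚ) + u (n + 1) := by
  have h : mHom u hu (Ideal.Quotient.mk _
      ((AddMonoidAlgebra.single (e n) 1 + AddMonoidAlgebra.single (e (n + 1)) 1 : Rinf)))
      = rHom u (AddMonoidAlgebra.single (e n) 1 + AddMonoidAlgebra.single (e (n + 1)) 1) := rfl
  rw [h, map_add, rHom_single, rHom_single]

/-- The values `u`: `2` at `1`, `-1` at odd `k ≤ N`, `1` elsewhere. -/
def uu (N : ℕ) (k : ℕ) : ℚˣ :=
  if k = 1 then Units.mk0 2 two_ne_zero else if Odd k ∧ k ≤ N then -1 else 1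

lemma uu_one (N : ℕ) : (uu N 1 : ℚ) = 2 := by simp [uu]

lemma uu_small (N n : ℕ) (h2 : 2 ≤ n) (he : Even n) (hN : n + 1 ≤ N) :
    (uu N n : ℚ) + uu N (n + 1) = 0 := by
  have h1 : n ≠ 1 := by omega
  have h3 : n ≠ 0 := by omega
  have h4 : ¬ Odd n := by simpa using he
  have h5 : Odd (n + 1) := he.add_one
  simp [uu, h1, h3, h4, h5, hN]

lemma uu_big (N n : ℕ) (h2 : 2 ≤ n) (he : Even n) (hN : N < n + 1) :
    (uu N n : ℚ) + uu N (n + 1) ≠ 0 := by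
  have h1 : n ≠ 1 := by omega
  have h3 : n ≠ 0 := by omega
  have h4 : ¬ Odd n := by simpa using he
  have h5 : ¬ (n + 1 ≤ N) := by omega
  simp [uu, h1, h3, h4, h5]

lemma eventually_zero (x : Mring) (hx : x ∈ bIdeal) :
    ∀ᶠ N in Filter.atTop, mHom (uu N) (uu_one N) x = 0 := by
  unfold bIdeal at hx
  induction hx using Submodule.span_induction with
  | mem x h =>
    obtain ⟨n, h2, he, rfl⟩ := h
    filter_upwards [Filter.eventually_ge_atTop (n + 1)] with N hN
    rw [mHom_gen]
    exact uu_small N n h2 he hN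
  | zero => simp
  | add x y _ _ hx hy =>
    filter_upwards [hx, hy] with N h1 h2
    rw [map_add, h1, h2, add_zero]
  | smul a x _ hx =>
    filter_upwards [hx] with N h1
    rw [smul_eq_mul, map_mul, h1, mul_zero]

/-- `𝔟` is a proper ideal of `M` which is not finitely generated as an
`R∞`-module (the `R∞`-module structure on `M` being induced by the quotient map). -/
theorem bIdeal_proper_and_not_fg_over_Rinf :
    bIdeal ≠ ⊤ ∧ ¬ (Submodule.restrictScalars Rinf bIdeal).FG := by
  constructor
  · intro h
    have h1 : (1 : Mring) ∈ bIdeal := h ▸ Submodule.mem_top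
    obtain ⟨N, hN⟩ := (eventually_zero 1 h1).exists
    rw [map_one] at hN
    exact one_ne_zero hN
  · rintro ⟨T, hT⟩
    have hev : ∀ᶠ N in Filter.atTop, ∀ x ∈ T, mHom (uu N) (uu_one N) x = 0 := by
      rw [Filter.eventually_all_finset]
      intro x hx
      apply eventually_zero
      have : x ∈ Submodule.restrictScalars Rinf bIdeal := hT ▸ Submodule.subset_span hx
      exact this
    obtain ⟨N, hN⟩ := hev.exists
    have hle : Submodule.restrictScalars Rinf bIdeal ≤
        Submodule.restrictScalars Rinf (RingHom.ker (mHom (uu N) (uu_one N))) := by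
      rw [← hT, Submodule.span_le]
      intro x hx
      exact hN x hx
    have hmem : (Ideal.Quotient.mk _ ((AddMonoidAlgebra.single (e (2 * N + 2)) 1 +
        AddMonoidAlgebra.single (e (2 * N + 2 + 1)) 1 : Rinf)) : Mring) ∈ bIdeal :=
      Ideal.subset_span ⟨2 * N + 2, by omega, ⟨N + 1, by omega⟩, rfl⟩
    have h0 : mHom (uu N) (uu_one N) _ = 0 := hle hmem
    rw [mHom_gen] at h0
    exact uu_big N (2 * N + 2) (by omega) ⟨N + 1, by omega⟩ (by omega) h0
end
end

section
/- There exists an expansive algebraic Λ-action with a non-expansive algebraic factor. Specifically, let M = R∞/(e(1) − 2), X = M̂ with the natural Λ-action α (which is expansive), and let 𝔟 ⊆ M be the ideal generated by the images of e(n) + e(n+1) for even n ≥ 2. Then the Λ-action β on Y = 𝔟̂ dual to multiplication on 𝔟 is non-expansive, and via the map dual to the inclusion 𝔟 ↪ M the system (Y, β) is a topological factor of (X, α) (i.e. there is a continuous surjective homomorphism π : X → Y with π ∘ α_m = β_m ∘ π for all m ∈ Λ). -/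
noncomputable section
set_option synthInstance.maxHeartbeats 1000000

/-- The circle group `𝕋 = ℝ/ℤ`. -/
abbrev Torus : Type := AddCircle (1 : ℝ)

/-- Expansiveness of a family of transformations. -/
def IsExpansive {I X : Type*} [TopologicalSpace X] [Zero X] (α : I → X → X) : Prop :=
  ∃ N ∈ nhds (0 : X), (⋂ i : I, α i '' N) = {0}

/-- The Pontryagin dual of a countable discrete abelian group `A`, realized as the
group of all characters `A → 𝕋` with the topology of pointwise convergence. -/
def Dual (A : Type*) [AddCommGroup A] : Type _ :=
  {x : A → Torus // ∀ p q : A, x (p + q) = x p + x q}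

instance (A : Type*) [AddCommGroup A] : TopologicalSpace (Dual A) :=
  instTopologicalSpaceSubtype

instance (A : Type*) [AddCommGroup A] : Zero (Dual A) :=
  ⟨⟨fun _ => 0, fun _ _ => by simp⟩⟩

instance (A : Type*) [AddCommGroup A] : Add (Dual A) :=
  ⟨fun x y => ⟨fun a => x.1 a + y.1 a, fun p q => by dsimp only; rw [x.2, y.2]; abel⟩⟩

/-- The image of `m ∈ Λ` in `M`. -/
def u (m : Lam) : Mring := Ideal.Quotient.mk _ (AddMonoidAlgebra.single m 1)

/-- The natural Λ-action `α` on `X = M̂`, dual to multiplication by `m` on `M`. -/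
def actX (m : Lam) (x : Dual Mring) : Dual Mring :=
  ⟨fun a => x.1 (u m * a), fun p q => by dsimp only; rw [mul_add]; exact x.2 _ _⟩

/-- The Λ-action `β` on `Y = 𝔟̂`, dual to multiplication by `m` on `𝔟`. -/
def actY (m : Lam) (y : Dual ↥bIdeal) : Dual ↥bIdeal :=
  ⟨fun w => y.1 ⟨u m * (w : Mring), Ideal.mul_mem_left _ _ w.2⟩, fun p q => by
    have h : (⟨u m * ((p + q : ↥bIdeal) : Mring), Ideal.mul_mem_left _ _ (p + q).2⟩ : ↥bIdeal)
        = ⟨u m * (p : Mring), Ideal.mul_mem_left _ _ p.2⟩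
          + ⟨u m * (q : Mring), Ideal.mul_mem_left _ _ q.2⟩ := by
      apply Subtype.ext
      push_cast
      ring
    dsimp only
    rw [h]
    exact y.2 _ _⟩

/-- The map `π : X → Y` dual to the inclusion `𝔟 ↪ M` (restriction of characters). -/
def piMap (x : Dual Mring) : Dual ↥bIdeal :=
  ⟨fun w => x.1 (w : Mring), fun p q => by
    have : ((p + q : ↥bIdeal) : Mring) = (p : Mring) + (q : Mring) := rfl
    dsimp only
    rw [this]; exact x.2 _ _⟩

theorem aux_u_add (m n : Lam) : u (m + n) = u m * u n := by
  unfold u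
  rw [← map_mul, AddMonoidAlgebra.single_mul_single, one_mul]

theorem aux_u_zero : u 0 = 1 := by
  unfold u
  rw [← AddMonoidAlgebra.one_def, map_one]

theorem aux_u_one : u (e 1) = 2 := by
  unfold u
  have : (Ideal.Quotient.mk (Ideal.span {(AddMonoidAlgebra.single (e 1) 1 - 2 : Rinf)}))
      (AddMonoidAlgebra.single (e 1) 1) = Ideal.Quotient.mk _ (2 : Rinf) := by
    rw [Ideal.Quotient.eq]
    exact Ideal.subset_span rfl
  rw [this, map_ofNat]

/-- a character as an additive hom -/
def auxHom {A : Type*} [AddCommGroup A] (x : Dual A) : A →+ Torus :=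
  AddMonoidHom.mk' x.1 x.2

theorem aux_dbl (t : Torus) (ht : ‖t‖ < 1 / 4) : ‖t + t‖ = 2 * ‖t‖ := by
  induction t using QuotientAddGroup.induction_on with
  | H r =>
    have h1 : ((r : ℝ) : Torus) = ((r - round r : ℝ) : Torus) := by
      rw [AddCircle.coe_sub]
      have : (((round r : ℤ) : ℝ) : Torus) = 0 := by
        rw [AddCircle.coe_eq_zero_iff]
        exact ⟨round r, by simp⟩
      rw [this, sub_zero]
    have h2 : ‖((r : ℝ) : Torus)‖ = |r - round r| := UnitAddCircle.norm_eq
    change ‖((r : ℝ) : Torus)‖ < 1 / 4 at ht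
    change ‖((r : ℝ) : Torus) + ((r : ℝ) : Torus)‖ = 2 * ‖((r : ℝ) : Torus)‖
    rw [h2] at ht ⊢
    rw [h1, ← AddCircle.coe_add]
    have h3 : |(r - round r) + (r - round r)| = 2 * |r - round r| := by
      rw [← two_mul, abs_mul, abs_two]
    rw [← h3]
    apply (AddCircle.norm_coe_eq_abs_iff (1 : ℝ) one_ne_zero).2
    rw [h3, abs_one]
    linarith

theorem aux_span (x : Dual Mring) (h : ∀ m, x.1 (u m) = 0) : x = 0 := by
  apply Subtype.ext
  funext a
  change auxHom x a = 0
  obtain ⟨r, rfl⟩ := Ideal.Quotient.mk_surjective a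
  have : (auxHom x).comp (Ideal.Quotient.mk (Ideal.span
      {(AddMonoidAlgebra.single (e 1) 1 - 2 : Rinf)})).toAddMonoidHom = 0 := by
    apply AddMonoidAlgebra.addMonoidHom_ext
    intro m c
    have h1 : (AddMonoidAlgebra.single m c : Rinf) = c • AddMonoidAlgebra.single m 1 := by
      rw [AddMonoidAlgebra.smul_single, smul_eq_mul, mul_one]
    rw [h1, map_zsmul]
    have : auxHom x (u m) = 0 := h m
    change c • auxHom x (u m) = _
    rw [this]; simp
  exact DFunLike.congr_fun this r

theorem aux_exp : IsExpansive actX := by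
  refine ⟨{x | ‖x.1 1‖ < 1 / 4}, ?_, ?_⟩
  · have hc : Continuous fun x : Dual Mring => ‖x.1 1‖ :=
      continuous_norm.comp ((continuous_apply (1 : Mring)).comp continuous_subtype_val)
    apply (isOpen_lt hc continuous_const).mem_nhds
    change ‖(0 : Torus)‖ < 1 / 4
    simp
  · apply Set.eq_singleton_iff_unique_mem.2
    constructor
    · refine Set.mem_iInter.2 fun m => ⟨0, ?_, rfl⟩
      change ‖(0 : Torus)‖ < 1 / 4
      simp
    · intro x hx
      have hs : ∀ m, ‖x.1 (u m)‖ < 1 / 4 := by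
        intro m
        obtain ⟨y, hy, rfl⟩ := Set.mem_iInter.1 hx (-m)
        change ‖y.1 (u (-m) * u m)‖ < 1 / 4
        rw [← aux_u_add, neg_add_cancel, aux_u_zero]
        exact hy
      have hd : ∀ (m : Lam), ‖x.1 (u (m + e 1))‖ = 2 * ‖x.1 (u m)‖ := by
        intro m
        rw [← aux_dbl _ (hs m), ← x.2, aux_u_add, aux_u_one, mul_two]
      have hk : ∀ (k : ℕ) (m : Lam), 2 ^ k * ‖x.1 (u m)‖ < 1 / 4 := by
        intro k
        induction k with
        | zero => intro m; simpa using hs m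
        | succ k ih => intro m; have := ih (m + e 1); rw [hd] at this; rw [pow_succ]; linarith
      apply aux_span
      intro m
      by_contra hne
      have hpos : 0 < ‖x.1 (u m)‖ := norm_pos_iff.2 hne
      obtain ⟨k, hk'⟩ := pow_unbounded_of_one_lt (1 / ‖x.1 (u m)‖) (one_lt_two)
      rw [div_lt_iff₀ hpos] at hk'
      linarith [hk k m]

theorem aux_surj : Function.Surjective piMap := by
  intro y
  obtain ⟨g, hg⟩ := (Module.Baer.of_divisible Torus).extension_property_addMonoidHom
    (bIdeal.subtype.toAddMonoidHom) Subtype.val_injective (auxHom y)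
  refine ⟨⟨g, map_add g⟩, ?_⟩
  apply Subtype.ext
  funext w
  exact DFunLike.congr_fun hg w

theorem aux_cont : Continuous piMap := by
  apply Continuous.subtype_mk
  exact continuous_pi fun w => (continuous_apply (w : Mring)).comp continuous_subtype_val

/-- values of the evaluation homs -/
def auxV (k n : ℕ) : ℚ := if n = 1 then 2 else if Odd n ∧ n ≤ k then -1 else 1

theorem auxV_ne (k n : ℕ) : auxV k n ≠ 0 := by
  unfold auxV; split_ifs <;> norm_num

/-- monoid hom -/
def auxMon (k : ℕ) : Multiplicative Lam →* ℚ where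
  toFun m := (Multiplicative.toAdd m).prod fun n a => auxV k n ^ a
  map_one' := by rw [toAdd_one]; exact Finsupp.prod_zero_index
  map_mul' a b := by
    rw [toAdd_mul]
    exact Finsupp.prod_add_index' (fun n => zpow_zero _) fun n b c => zpow_add₀ (auxV_ne k n) b c

/-- evaluation on Rinf -/
def auxR (k : ℕ) : Rinf →+* ℚ := (AddMonoidAlgebra.lift ℤ ℚ Lam (auxMon k)).toRingHom

theorem auxR_e (k n : ℕ) : auxR k (AddMonoidAlgebra.single (e n) 1) = auxV k n := by
  change AddMonoidAlgebra.lift ℤ ℚ Lam (auxMon k) _ = _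
  rw [AddMonoidAlgebra.lift_single, one_smul]
  change (Finsupp.single n (1 : ℤ)).prod (fun n a => auxV k n ^ a) = _
  rw [Finsupp.prod_single_index (zpow_zero _), zpow_one]

/-- evaluation on Mring -/
def auxM (k : ℕ) : Mring →+* ℚ := Ideal.Quotient.lift _ (auxR k) (by
  intro a ha
  have : Ideal.span {(AddMonoidAlgebra.single (e 1) 1 - 2 : Rinf)} ≤ RingHom.ker (auxR k) := by
    rw [Ideal.span_le, Set.singleton_subset_iff]
    change auxR k _ = 0
    rw [map_sub, auxR_e, map_ofNat]
    simp [auxV]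
  exact this ha)

theorem auxM_gen (k n : ℕ) : auxM k (Ideal.Quotient.mk _ ((AddMonoidAlgebra.single (e n) 1
          + AddMonoidAlgebra.single (e (n + 1)) 1 : Rinf))) = auxV k n + auxV k (n + 1) := by
  change auxR k _ = _
  rw [map_add, auxR_e, auxR_e]

theorem auxM_ev (w : Mring) (hw : w ∈ bIdeal) : ∀ᶠ k in Filter.atTop, auxM k w = 0 := by
  unfold bIdeal at hw
  induction hw using Submodule.span_induction with
  | mem y hy =>
    obtain ⟨n, hn, he, rfl⟩ := hy
    filter_upwards [Filter.eventually_ge_atTop (n + 1)] with k hk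
    rw [auxM_gen]
    have h1 : ¬ Odd n := Nat.not_odd_iff_even.2 he
    have h2 : Odd (n + 1) := he.add_one
    unfold auxV
    rw [if_neg (by omega), if_neg (by tauto), if_neg (by omega), if_pos ⟨h2, hk⟩]
    norm_num
  | zero => exact Filter.Eventually.of_forall fun k => map_zero _
  | add a b _ _ ha hb =>
    filter_upwards [ha, hb] with k h1 h2
    rw [map_add, h1, h2, add_zero]
  | smul r a _ ha =>
    filter_upwards [ha] with k h
    rw [smul_eq_mul, map_mul, h, mul_zero]

/-- the small characters -/
def auxY (k : ℕ) : Dual ↥bIdeal :=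
  ⟨fun w => (((auxM k (w : Mring) / 4 : ℚ) : ℝ) : Torus), fun p q => by
    have : ((p + q : ↥bIdeal) : Mring) = (p : Mring) + (q : Mring) := rfl
    dsimp only
    rw [this, map_add, add_div, Rat.cast_add, AddCircle.coe_add]⟩

theorem auxY_ne (k : ℕ) : auxY k ≠ 0 := by
  intro h
  have hm : Ideal.Quotient.mk _ ((AddMonoidAlgebra.single (e (2 * k + 2)) 1
          + AddMonoidAlgebra.single (e (2 * k + 2 + 1)) 1 : Rinf)) ∈ bIdeal :=
    Ideal.subset_span ⟨2 * k + 2, by omega, ⟨k + 1, by ring⟩, rfl⟩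
  have h1 : (auxY k).1 ⟨_, hm⟩ = 0 := by rw [h]; rfl
  change (((auxM k _ / 4 : ℚ) : ℝ) : Torus) = 0 at h1
  rw [auxM_gen] at h1
  unfold auxV at h1
  rw [if_neg (by omega), if_neg (by omega), if_neg (by omega), if_neg (by omega)] at h1
  rw [AddCircle.coe_eq_zero_iff] at h1
  obtain ⟨n, hn⟩ := h1
  rw [zsmul_eq_mul, mul_one] at hn
  have h3 : (2 * n : ℝ) = 1 := by rw [hn]; norm_num
  have h4 : 2 * n = 1 := by exact_mod_cast h3
  omega

theorem aux_nonexp : ¬ IsExpansive actY := by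
  rintro ⟨N, hN, hI⟩
  obtain ⟨S, hS, hSN⟩ := (mem_nhds_induced _ _ _).1 hN
  rw [nhds_pi, Filter.mem_pi'] at hS
  obtain ⟨I, t, ht, hIt⟩ := hS
  have hev : ∀ᶠ k in Filter.atTop, ∀ w ∈ I, auxM k (w : Mring) = 0 :=
    (Finset.eventually_all I).2 fun w _ => auxM_ev w w.2
  obtain ⟨k, hk⟩ := hev.exists
  have hmem : auxY k ∈ ⋂ i : Lam, actY i '' N := by
    refine Set.mem_iInter.2 fun m => ⟨actY (-m) (auxY k), ?_, ?_⟩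
    · apply hSN
      apply hIt
      intro w hw
      change (((auxM k (u (-m) * (w : Mring)) / 4 : ℚ) : ℝ) : Torus) ∈ t w
      rw [map_mul, hk w hw, mul_zero, zero_div, Rat.cast_zero]
      exact mem_of_mem_nhds (ht w)
    · apply Subtype.ext
      funext w
      change (((auxM k (u (-m) * (u m * (w : Mring))) / 4 : ℚ) : ℝ) : Torus) =
        (((auxM k (w : Mring) / 4 : ℚ) : ℝ) : Torus)
      rw [← mul_assoc, ← aux_u_add, neg_add_cancel, aux_u_zero, one_mul]
  rw [hI] at hmem
  exact auxY_ne k hmem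

/-- `(X, α)` is expansive, its factor `(Y, β)` (via the continuous
surjective homomorphism `π` dual to the inclusion `𝔟 ↪ M`, which intertwines the
actions) is non-expansive. -/
theorem expansive_action_with_nonexpansive_factor :
    IsExpansive actX ∧
    ¬ IsExpansive actY ∧
    Continuous piMap ∧
    Function.Surjective piMap ∧
    (∀ x y : Dual Mring, piMap (x + y) = piMap x + piMap y) ∧
    (∀ m : Lam, piMap ∘ actX m = actY m ∘ piMap) := by
  exact ⟨aux_exp, aux_nonexp, aux_cont, aux_surj, fun _ _ => rfl, fun _ => rfl⟩
end
end
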